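/- arXiv:1209.1032 — 2 statements merged into one kernel-verified Lean document; each statement's English description precedes it below -/
import Mathlib

section
/- Let M be a positive integer, let w : Fin M → ℝ be nonnegative weights, Q > 0, β > 0, and b : Fin M → ℝ nonnegative. Define the group utility of an allocation l : Fin M → ℕ as U(l) = ∑_{k=0}^{M-1} w k · log( Q + β · ∑_{m ≤ k} b m · l m ). Then for any two allocations l¹, l² : Fin M → ℕ, U(l¹) − U(l²) ≤ ∑_{m=0}^{M-1} max((l¹ m : ℝ) − (l² m), 0) · ( U(l² + e_m) − U(l²) ), where l² + e_m denotes l² with its m-th coordinate increased by 1. -/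
/-- A Bernoulli-type inequality: `1 + ∑ n i * x i ≤ ∏ (1 + x i) ^ n i` for nonnegative `x`. -/
theorem one_add_sum_mul_le_prod_pow {ι : Type*} (s : Finset ι) (x : ι → ℝ)
    (hx : ∀ i, 0 ≤ x i) (n : ι → ℕ) :
    1 + ∑ i ∈ s, (n i : ℝ) * x i ≤ ∏ i ∈ s, (1 + x i) ^ n i := by
  classical
  induction s using Finset.induction_on with
  | empty => simp
  | insert a s ha ih =>
    rw [Finset.sum_insert ha, Finset.prod_insert ha]
    have hsum : 0 ≤ ∑ i ∈ s, (n i : ℝ) * x i :=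
      Finset.sum_nonneg fun i _ => mul_nonneg (Nat.cast_nonneg _) (hx i)
    have hna : 0 ≤ (n a : ℝ) * x a := mul_nonneg (Nat.cast_nonneg _) (hx a)
    have hpow : 1 + (n a : ℝ) * x a ≤ (1 + x a) ^ n a :=
      one_add_mul_le_pow (by linarith [hx a]) (n a)
    have hmul := mul_le_mul hpow ih (by linarith) (by linarith)
    nlinarith [mul_nonneg hna hsum]

/-- The increment of `log` at `A` along a sum of nonnegative steps, each repeated `n i` times, is at
most the sum of the increments along the individual steps. -/
theorem log_add_sum_sub_log_le {ι : Type*} (s : Finset ι) {A : ℝ} (hA : 0 < A) (c : ι → ℝ)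
    (hc : ∀ i, 0 ≤ c i) (n : ι → ℕ) :
    Real.log (A + ∑ i ∈ s, (n i : ℝ) * c i) - Real.log A ≤
      ∑ i ∈ s, (n i : ℝ) * (Real.log (A + c i) - Real.log A) := by
  have hx : ∀ i, 0 ≤ c i / A := fun i => div_nonneg (hc i) hA.le
  have hsum : 0 ≤ ∑ i ∈ s, (n i : ℝ) * c i :=
    Finset.sum_nonneg fun i _ => mul_nonneg (Nat.cast_nonneg _) (hc i)
  have hlog : ∀ i, Real.log (A + c i) - Real.log A = Real.log (1 + c i / A) := fun i => by
    rw [← Real.log_div (by linarith [hc i]) hA.ne', add_div, div_self hA.ne']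
  have hdiv : (A + ∑ i ∈ s, (n i : ℝ) * c i) / A = 1 + ∑ i ∈ s, (n i : ℝ) * (c i / A) := by
    rw [add_div, div_self hA.ne', Finset.sum_div]
    simp only [mul_div_assoc]
  rw [← Real.log_div (by linarith) hA.ne']
  calc Real.log ((A + ∑ i ∈ s, (n i : ℝ) * c i) / A)
      ≤ Real.log (∏ i ∈ s, (1 + c i / A) ^ n i) :=
        Real.log_le_log (by positivity) (hdiv.trans_le (one_add_sum_mul_le_prod_pow s _ hx n))
    _ = ∑ i ∈ s, (n i : ℝ) * (Real.log (A + c i) - Real.log A) := by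
        rw [Real.log_prod fun i _ => (pow_pos (by linarith [hx i]) _).ne']
        simp only [Real.log_pow, hlog]

/-- Adding one unit in coordinate `m` to an allocation raises its weighted sum over `s` by `b m`
if `m ∈ s`, and leaves it unchanged otherwise. -/
theorem sum_mul_update_succ {ι : Type*} [DecidableEq ι] (s : Finset ι) (b : ι → ℝ) (l : ι → ℕ)
    (m : ι) :
    ∑ i ∈ s, b i * (Function.update l m (l m + 1) i : ℝ) =
      ∑ i ∈ s, b i * (l i : ℝ) + if m ∈ s then b m else 0 := by
  have hi : ∀ i, b i * (Function.update l m (l m + 1) i : ℝ) =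
      b i * (l i : ℝ) + if m = i then b i else 0 := fun i => by
    rcases eq_or_ne m i with rfl | h
    · simp [mul_add]
    · simp [h, h.symm]
  simp only [hi, Finset.sum_add_distrib, Finset.sum_ite_eq]


open Finset in
/-- The group-utility difference bound used in the optimality-gap proof of the
greedy tile allocation algorithm. -/
theorem group_utility_difference_bound
    (M : ℕ) (hM : 0 < M) (w : Fin M → ℝ) (hw : ∀ k, 0 ≤ w k)
    (Q β : ℝ) (hQ : 0 < Q) (hβ : 0 < β)
    (b : Fin M → ℝ) (hb : ∀ m, 0 ≤ b m)
    (U : (Fin M → ℕ) → ℝ)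
    (hU : ∀ l : Fin M → ℕ,
      U l = ∑ k, w k * Real.log (Q + β * ∑ m ∈ Finset.Iic k, b m * (l m : ℝ)))
    (l₁ l₂ : Fin M → ℕ) :
    U l₁ - U l₂ ≤
      ∑ m, max ((l₁ m : ℝ) - (l₂ m : ℝ)) 0 *
        (U (Function.update l₂ m (l₂ m + 1)) - U l₂) := by
  have hmax : ∀ m, max ((l₁ m : ℝ) - l₂ m) 0 = ((l₁ m - l₂ m : ℕ) : ℝ) := fun m => by
    rcases le_total (l₁ m) (l₂ m) with h | h
    · simp [h]
    · simp [Nat.cast_sub h, h]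
  simp only [hmax, hU, ← Finset.sum_sub_distrib]
  rw [Finset.sum_congr rfl fun m _ => Finset.mul_sum _ _ _, Finset.sum_comm]
  refine Finset.sum_le_sum fun k _ => ?_
  set A := Q + β * ∑ m ∈ Finset.Iic k, b m * (l₂ m : ℝ) with hA
  have hApos : 0 < A :=
    add_pos_of_pos_of_nonneg hQ <| mul_nonneg hβ.le <|
      Finset.sum_nonneg fun m _ => mul_nonneg (hb m) (Nat.cast_nonneg _)
  have hbound : Q + β * ∑ m ∈ Finset.Iic k, b m * (l₁ m : ℝ) ≤
      A + ∑ m ∈ Finset.Iic k, ((l₁ m - l₂ m : ℕ) : ℝ) * (β * b m) := by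
    rw [hA, add_assoc, Finset.mul_sum, Finset.mul_sum, ← Finset.sum_add_distrib]
    gcongr with m
    have hle : (l₁ m : ℝ) ≤ l₂ m + (l₁ m - l₂ m : ℕ) := by
      exact_mod_cast (by omega : l₁ m ≤ l₂ m + (l₁ m - l₂ m))
    nlinarith [mul_le_mul_of_nonneg_left hle (mul_nonneg hβ.le (hb m))]
  have hpos : 0 < Q + β * ∑ m ∈ Finset.Iic k, b m * (l₁ m : ℝ) :=
    add_pos_of_pos_of_nonneg hQ <| mul_nonneg hβ.le <|
      Finset.sum_nonneg fun m _ => mul_nonneg (hb m) (Nat.cast_nonneg _)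
  have hstep : ∀ m, ((l₁ m - l₂ m : ℕ) : ℝ) *
      (w k * Real.log (Q + β * ∑ i ∈ Finset.Iic k,
        b i * (Function.update l₂ m (l₂ m + 1) i : ℝ)) - w k * Real.log A) =
      if m ∈ Finset.Iic k then
        w k * (((l₁ m - l₂ m : ℕ) : ℝ) * (Real.log (A + β * b m) - Real.log A)) else 0 :=
    fun m => by
      rw [sum_mul_update_succ, mul_add, ← add_assoc, ← hA]
      split_ifs
      · ring
      · simp
  simp only [hstep]
  rw [Finset.sum_ite_mem, Finset.univ_inter, ← Finset.mul_sum, ← mul_sub]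
  refine mul_le_mul_of_nonneg_left ?_ (hw k)
  exact (sub_le_sub_right (Real.log_le_log hpos hbound) _).trans
    (log_add_sum_sub_log_le _ hApos _ (fun m => mul_nonneg hβ.le (hb m)) _)
end

section
/- Let R > 0, let k be a positive integer, and let d : Fin k → ℝ satisfy 0 ≤ d t ≤ 2R for all t and ∑_t d t ≥ R. Let F : ℕ → ℝ satisfy F 0 ≥ 0 and F (t+1) ≤ F t · (1 − d t/(2R)) for all t < k. Then F k ≤ F 0 · e^{−1/2}. (In the paper: the utility gap F_t between the optimal tile allocation and the greedy allocation after t iterations satisfies this recursion with d_t = b_{ĝ,m̂}(t) + R/T_e, ∑_t d_t ≥ R at termination, and hence the greedy algorithm GRD1 returns a solution with U(l_k) ≥ (1 − e^{−1/2}) U(l*), i.e., within a factor (1 − e^{−1/2}) of the global optimum.) -/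
/-- A discrete Grönwall inequality: a sequence contracted by `1 - c t` at each step
decays at least as fast as `exp (-∑ c t)`. -/
theorem le_mul_exp_neg_sum_of_step_le {k : ℕ} {c : Fin k → ℝ} {F : ℕ → ℝ}
    (hc : ∀ t, c t ≤ 1) (hF0 : 0 ≤ F 0)
    (hrec : ∀ t : Fin k, F (t.val + 1) ≤ F t.val * (1 - c t)) :
    F k ≤ F 0 * Real.exp (-∑ t, c t) := by
  induction k with
  | zero => simp
  | succ n ih =>
    have hn : F n ≤ F 0 * Real.exp (-∑ t : Fin n, c t.castSucc) :=
      ih (fun t => hc t.castSucc) (fun t => hrec t.castSucc)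
    have hlast : F (n + 1) ≤ F n * (1 - c (Fin.last n)) := hrec (Fin.last n)
    have hnonneg : 0 ≤ 1 - c (Fin.last n) := sub_nonneg.2 (hc _)
    calc F (n + 1) ≤ F n * (1 - c (Fin.last n)) := hlast
      _ ≤ F 0 * Real.exp (-∑ t : Fin n, c t.castSucc) * (1 - c (Fin.last n)) :=
        mul_le_mul_of_nonneg_right hn hnonneg
      _ ≤ F 0 * Real.exp (-∑ t : Fin n, c t.castSucc) * Real.exp (-c (Fin.last n)) :=
        mul_le_mul_of_nonneg_left (Real.one_sub_le_exp_neg _) (by positivity)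
      _ = F 0 * Real.exp (-∑ t, c t) := by
        rw [Fin.sum_univ_castSucc, neg_add, Real.exp_add, mul_assoc]

/-- The optimality gap of the greedy algorithm GRD1: the utility gap after k
iterations is at most e^{−1/2} times the initial gap. -/
theorem greedy_optimality_gap
    (R : ℝ) (hR : 0 < R) (k : ℕ) (hk : 0 < k)
    (d : Fin k → ℝ) (hd : ∀ t, 0 ≤ d t ∧ d t ≤ 2 * R)
    (hsum : R ≤ ∑ t, d t)
    (F : ℕ → ℝ) (hF0 : 0 ≤ F 0)
    (hrec : ∀ t : Fin k, F (t.val + 1) ≤ F t.val * (1 - d t / (2 * R))) :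
    F k ≤ F 0 * Real.exp (-1 / 2) := by
  have h2R : 0 < 2 * R := by positivity
  refine (le_mul_exp_neg_sum_of_step_le
    (fun t => (div_le_one h2R).2 (hd t).2) hF0 hrec).trans ?_
  have hhalf : 1 / 2 ≤ ∑ t, d t / (2 * R) := by
    rw [← Finset.sum_div, le_div_iff₀ h2R]
    linarith
  exact mul_le_mul_of_nonneg_left (Real.exp_le_exp.2 (by linarith)) hF0
end
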